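/- Let P be a finite set of points and L a finite set of non-vertical lines in ℂ², such that every point of P lies on at least two lines of L. Let d denote the projective duality sending the line {(x,y) : y = ax + b} to the point (a, −b) and the point (a,b) to the line {(x,y) : y = ax − b}, let T ⊆ (P choose 3) be the collection of triples of points of P lying on a common line of L, and let T* ⊆ (L choose 3) be the collection of triples of lines of L passing through a common point of P. Let r be a positive integer. If the tuple of dual points d(L) = (d(ℓ))_{ℓ∈L} is r-rigid with respect to T*, then P is r-rigid with respect to T. -/

import Mathlib

noncomputable section

open MvPolynomial

/-- Flatten a tuple of points of `ℂ²` indexed by `S` into a point of affine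
space with coordinates indexed by `S × Fin 2`. -/
def flatten {S : Type*} (Q : S → ℂ × ℂ) : S × Fin 2 → ℂ :=
  fun v => if v.2 = 0 then (Q v.1).1 else (Q v.1).2

/-- A subset of `(ℂ²)^S` is Zariski closed if it is the common zero locus of a
family of polynomials in the `2|S|` coordinates. -/
def ZClosed {S : Type*} (V : Set (S → ℂ × ℂ)) : Prop :=
  ∃ I : Set (MvPolynomial (S × Fin 2) ℂ),
    V = {Q | ∀ f ∈ I, eval (flatten Q) f = 0}

/-- A subset of `(ℂ²)^S` is irreducible if it is Zariski closed, nonempty, and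
is not covered by two Zariski closed sets without being inside one of them. -/
def ZIrred {S : Type*} (V : Set (S → ℂ × ℂ)) : Prop :=
  ZClosed V ∧ V.Nonempty ∧
    ∀ V₁ V₂ : Set (S → ℂ × ℂ), ZClosed V₁ → ZClosed V₂ → V ⊆ V₁ ∪ V₂ →
      V ⊆ V₁ ∨ V ⊆ V₂

/-- `V` is an irreducible component of `K`: an irreducible closed subset of `K`
that is maximal among irreducible closed subsets of `K`. -/
def IsIrredComponent {S : Type*} (K V : Set (S → ℂ × ℂ)) : Prop :=
  ZIrred V ∧ V ⊆ K ∧ ∀ W : Set (S → ℂ × ℂ), ZIrred W → W ⊆ K → V ⊆ W → V = W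

/-- The (Krull) dimension of `V` is at most `r`: every strictly increasing chain
`c 0 ⊂ c 1 ⊂ ⋯ ⊂ c k` of irreducible closed subsets of `V` has `k ≤ r`. -/
def ZDimLE {S : Type*} (V : Set (S → ℂ × ℂ)) (r : ℕ) : Prop :=
  ∀ (k : ℕ) (c : Fin (k + 1) → Set (S → ℂ × ℂ)),
    (∀ i, ZIrred (c i)) → (∀ i, c i ⊆ V) → StrictMono c → k ≤ r

/-- The variety `K_T ⊆ (ℂ²)^S` of tuples of points satisfying the collinearity
conditions given by the triples in `T`. -/
def KT {S : Type*} (T : Set (Set S)) : Set (S → ℂ × ℂ) :=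
  {Q | ∀ t ∈ T, Collinear ℂ (Q '' t)}

/-- `P ∈ K_T` is `r`-rigid with respect to `T` if every irreducible component of
`K_T` containing `P` has dimension at most `r`. -/
def IsRigid {S : Type*} (T : Set (Set S)) (P : S → ℂ × ℂ) (r : ℕ) : Prop :=
  P ∈ KT T ∧
    ∀ V : Set (S → ℂ × ℂ), IsIrredComponent (KT T) V → P ∈ V → ZDimLE V r


/-- The non-vertical line `y = a x + b` in `ℂ²` with parameters `l = (a, b)`. -/
def lineOf (l : ℂ × ℂ) : Set (ℂ × ℂ) := {p : ℂ × ℂ | p.2 = l.1 * p.1 + l.2}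

/-- The dual point of the non-vertical line `y = a x + b`, namely `(a, -b)`. -/
def dualPoint (l : ℂ × ℂ) : ℂ × ℂ := (l.1, -l.2)

/-- Krull dimension is invariant under injective integral extensions. -/
theorem ringKrullDim_eq_of_isIntegral {R S : Type*} [CommRing R] [CommRing S] [Algebra R S]
    [Algebra.IsIntegral R S] (hinj : Function.Injective (algebraMap R S)) :
    ringKrullDim S = ringKrullDim R := by
  apply le_antisymm
  · exact Order.krullDim_le_of_strictMono (PrimeSpectrum.comap (algebraMap R S))
      fun _ _ h ↦ Ideal.IsIntegral.comap_lt_comap h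
  · refine iSup_le fun l ↦ ?_
    obtain ⟨Q, -, hQ, hQl⟩ := Ideal.exists_ideal_over_prime_of_isIntegral l.head.asIdeal
      (⊥ : Ideal S) (by
        rw [← RingHom.ker_eq_comap_bot, (RingHom.injective_iff_ker_eq_bot _).1 hinj]
        exact bot_le)
    have : Q.LiesOver l.head.asIdeal := ⟨hQl.symm⟩
    obtain ⟨M, hM, -⟩ := Ideal.exists_ltSeries_of_hasGoingUp l Q
    exact hM ▸ Order.LTSeries.length_le_krullDim M

/-- The transcendence degree does not change under an injective algebraic extension. -/
theorem trdeg_eq_of_isAlgebraic (K A B : Type) [Field K] [CommRing A] [CommRing B] [IsDomain B]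
    [Algebra K A] [Algebra K B] [Algebra A B] [IsScalarTower K A B]
    (hinj : Function.Injective (algebraMap A B)) [Algebra.IsAlgebraic A B] :
    Algebra.trdeg K A = Algebra.trdeg K B := by
  have : FaithfulSMul A B := (faithfulSMul_iff_algebraMap_injective A B).2 hinj
  have : Nontrivial A := (algebraMap A B).domain_nontrivial
  rw [← trdeg_add_eq K A (A := B), trdeg_eq_zero (R := A), add_zero]

/-- The Krull dimension of a finitely generated domain over a field is its transcendence degree. -/
theorem exists_ringKrullDim_eq_trdeg (K A : Type) [Field K] [CommRing A] [IsDomain A]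
    [Algebra K A] [Algebra.FiniteType K A] :
    ∃ n : ℕ, ringKrullDim A = n ∧ Algebra.trdeg K A = n := by
  obtain ⟨n, g, hg, hint⟩ := exists_integral_inj_algHom_of_fg K A
  let _ : Algebra (MvPolynomial (Fin n) K) A := g.toRingHom.toAlgebra
  have : IsScalarTower K (MvPolynomial (Fin n) K) A :=
    .of_algebraMap_eq fun x ↦ (g.commutes x).symm
  have : Algebra.IsIntegral (MvPolynomial (Fin n) K) A := ⟨hint⟩
  refine ⟨n, ?_, ?_⟩
  · rw [ringKrullDim_eq_of_isIntegral (R := MvPolynomial (Fin n) K) hg]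
    simp
  · rw [← trdeg_eq_of_isAlgebraic K (MvPolynomial (Fin n) K) A hg]
    simp

/-- If two finitely generated domains `A`, `B` over a field embed into a common domain, and the
image of `A` is algebraic over `B`, then `dim A ≤ dim B`. -/
theorem ringKrullDim_le_of_isAlgebraic {K A B O : Type} [Field K] [CommRing A] [IsDomain A]
    [CommRing B] [IsDomain B] [CommRing O] [IsDomain O] [Algebra K A] [Algebra K B] [Algebra K O]
    [Algebra.FiniteType K A] [Algebra.FiniteType K B] [Algebra B O] [IsScalarTower K B O]
    (hB : Function.Injective (algebraMap B O)) (f : A →ₐ[K] O) (hf : Function.Injective f)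
    (halg : ∀ a, IsAlgebraic B (f a)) : ringKrullDim A ≤ ringKrullDim B := by
  obtain ⟨m, hm, hm'⟩ := exists_ringKrullDim_eq_trdeg K A
  obtain ⟨n, hn, hn'⟩ := exists_ringKrullDim_eq_trdeg K B
  let C := Subalgebra.algebraicClosure B O
  have h₁ : Algebra.trdeg K A ≤ Algebra.trdeg K C :=
    trdeg_le_of_injective (f.codRestrict (C.restrictScalars K) halg)
      ((AlgHom.injective_codRestrict f _ halg).2 hf)
  have h₂ : Algebra.trdeg K B = Algebra.trdeg K C :=
    trdeg_eq_of_isAlgebraic K B C fun x y h ↦ hB (congrArg Subtype.val h)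
  rw [← h₂, hm', hn'] at h₁
  rw [hm, hn]
  exact_mod_cast h₁

/-- The ideal of polynomials vanishing on a subset of `(ℂ²)^S`. -/
def idealOf {S : Type*} (V : Set (S → ℂ × ℂ)) : Ideal (MvPolynomial (S × Fin 2) ℂ) :=
  vanishingIdeal ℂ (flatten '' V)

/-- The common zero locus of an ideal in `(ℂ²)^S`. -/
def zeroSet {S : Type*} (I : Ideal (MvPolynomial (S × Fin 2) ℂ)) : Set (S → ℂ × ℂ) :=
  flatten ⁻¹' zeroLocus ℂ I

section ZariskiClosed

variable {S : Type*}

theorem mem_idealOf {V : Set (S → ℂ × ℂ)} {f : MvPolynomial (S × Fin 2) ℂ} :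
    f ∈ idealOf V ↔ ∀ Q ∈ V, eval (flatten Q) f = 0 := by
  simp [idealOf, aeval_eq_eval]

theorem mem_zeroSet {I : Ideal (MvPolynomial (S × Fin 2) ℂ)} {Q : S → ℂ × ℂ} :
    Q ∈ zeroSet I ↔ ∀ f ∈ I, eval (flatten Q) f = 0 := by
  simp [zeroSet, aeval_eq_eval]

theorem flatten_surjective : Function.Surjective (flatten : (S → ℂ × ℂ) → S × Fin 2 → ℂ) := by
  refine fun x ↦ ⟨fun s ↦ (x (s, 0), x (s, 1)), ?_⟩
  ext ⟨s, i⟩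
  fin_cases i <;> simp [flatten]

theorem zeroSet_anti {I J : Ideal (MvPolynomial (S × Fin 2) ℂ)} (h : I ≤ J) :
    zeroSet J ⊆ zeroSet I :=
  Set.preimage_mono (zeroLocus_anti_mono h)

theorem idealOf_anti {V W : Set (S → ℂ × ℂ)} (h : V ⊆ W) : idealOf W ≤ idealOf V :=
  vanishingIdeal_anti_mono (Set.image_mono h)

theorem zClosed_zeroSet (I : Ideal (MvPolynomial (S × Fin 2) ℂ)) : ZClosed (zeroSet I) :=
  ⟨I, Set.ext fun _ ↦ mem_zeroSet⟩

theorem ZClosed.zeroSet_idealOf {V : Set (S → ℂ × ℂ)} (hV : ZClosed V) :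
    zeroSet (idealOf V) = V := by
  obtain ⟨I, rfl⟩ := hV
  refine Set.Subset.antisymm (fun Q hQ f hf ↦ ?_) fun Q hQ ↦ ?_
  · exact mem_zeroSet.1 hQ f (mem_idealOf.2 fun R hR ↦ hR f hf)
  · exact mem_zeroSet.2 fun f hf ↦ mem_idealOf.1 hf Q hQ

theorem ZIrred.isPrime_idealOf {V : Set (S → ℂ × ℂ)} (hV : ZIrred V) : (idealOf V).IsPrime := by
  obtain ⟨-, ⟨Q, hQ⟩, hirr⟩ := hV
  refine ⟨fun h ↦ ?_, fun {f g} hfg ↦ ?_⟩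
  · simpa using mem_idealOf.1 ((Ideal.eq_top_iff_one _).1 h) Q hQ
  · have key : ∀ h : MvPolynomial (S × Fin 2) ℂ, ZClosed {R | eval (flatten R) h = 0} :=
      fun h ↦ ⟨{h}, by simp⟩
    refine (hirr _ _ (key f) (key g) fun R hR ↦ ?_).imp mem_idealOf.2 mem_idealOf.2
    simpa using mem_idealOf.1 hfg R hR

variable [Finite S]

theorem idealOf_zeroSet (p : Ideal (MvPolynomial (S × Fin 2) ℂ)) [p.IsPrime] :
    idealOf (zeroSet p) = p := by
  rw [idealOf, zeroSet, Set.image_preimage_eq _ flatten_surjective, IsPrime.vanishingIdeal_zeroLocus]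

theorem zIrred_zeroSet (p : Ideal (MvPolynomial (S × Fin 2) ℂ)) [hp : p.IsPrime] :
    ZIrred (zeroSet p) := by
  refine ⟨zClosed_zeroSet p, ?_, fun V₁ V₂ h₁ h₂ h ↦ ?_⟩
  · by_contra hne
    rw [Set.not_nonempty_iff_eq_empty] at hne
    refine hp.ne_top ?_
    rw [← idealOf_zeroSet p, hne, Ideal.eq_top_iff_one]
    exact mem_idealOf.2 (by simp)
  · have hle : idealOf V₁ * idealOf V₂ ≤ p := by
      rw [← idealOf_zeroSet p]
      refine Ideal.mul_le.2 fun f hf g hg ↦ mem_idealOf.2 fun Q hQ ↦ ?_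
      rw [map_mul]
      rcases h hQ with hQ | hQ
      · rw [mem_idealOf.1 hf Q hQ, zero_mul]
      · rw [mem_idealOf.1 hg Q hQ, mul_zero]
    rw [← h₁.zeroSet_idealOf, ← h₂.zeroSet_idealOf]
    exact (hp.mul_le.1 hle).imp zeroSet_anti zeroSet_anti

/-- An irreducible closed subset of a closed set is contained in an irreducible component. -/
theorem exists_isIrredComponent {K W : Set (S → ℂ × ℂ)} (hK : ZClosed K) (hW : ZIrred W)
    (hWK : W ⊆ K) : ∃ V, IsIrredComponent K V ∧ W ⊆ V := by
  have := hW.isPrime_idealOf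
  obtain ⟨p, hp, hpW⟩ := Ideal.exists_minimalPrimes_le (idealOf_anti hWK)
  have := hp.1.1
  refine ⟨zeroSet p, ⟨zIrred_zeroSet p, ?_, fun V hV hVK hpV ↦ ?_⟩, ?_⟩
  · exact (zeroSet_anti hp.1.2).trans hK.zeroSet_idealOf.subset
  · refine hpV.antisymm ?_
    have hle : idealOf V ≤ p := by
      simpa [idealOf_zeroSet] using idealOf_anti hpV
    have := zeroSet_anti (hp.2 ⟨hV.isPrime_idealOf, idealOf_anti hVK⟩ hle)
    rwa [hV.1.zeroSet_idealOf] at this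
  · exact hW.1.zeroSet_idealOf.superset.trans (zeroSet_anti hpW)

/-- The dimension of an irreducible closed set is the Krull dimension of its coordinate ring. -/
theorem ZIrred.zDimLE_iff {V : Set (S → ℂ × ℂ)} (hV : ZIrred V) {r : ℕ} :
    ZDimLE V r ↔ ringKrullDim (MvPolynomial (S × Fin 2) ℂ ⧸ idealOf V) ≤ r := by
  rw [ringKrullDim_quotient]
  constructor
  · refine fun h ↦ iSup_le fun l ↦ Nat.cast_le.2 (h l.length
      (fun i ↦ zeroSet (l i.rev).1.asIdeal) (fun i ↦ zIrred_zeroSet _) (fun i ↦ ?_) ?_)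
    · exact (zeroSet_anti (l i.rev).2).trans hV.1.zeroSet_idealOf.subset
    · intro i j hij
      have hlt := l.strictMono (Fin.rev_lt_rev.2 hij)
      refine lt_of_le_not_ge (zeroSet_anti hlt.le) fun hge ↦ hlt.not_ge ?_
      have := idealOf_anti hge
      rwa [idealOf_zeroSet, idealOf_zeroSet] at this
  · intro h k c hc hcV hmono
    have hanti {i j} (hij : i < j) : idealOf (c j) < idealOf (c i) := by
      refine lt_of_le_not_ge (idealOf_anti (hmono hij).le) fun hge ↦ (hmono hij).not_ge ?_
      have := zeroSet_anti hge
      rwa [(hc i).1.zeroSet_idealOf, (hc j).1.zeroSet_idealOf] at this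
    let l : LTSeries (PrimeSpectrum.zeroLocus
        (idealOf V : Set (MvPolynomial (S × Fin 2) ℂ))) :=
      LTSeries.mk k (fun i ↦ ⟨⟨idealOf (c i.rev), (hc i.rev).isPrime_idealOf⟩,
        idealOf_anti (hcV i.rev)⟩) fun i j hij ↦ hanti (Fin.rev_lt_rev.2 hij)
    exact_mod_cast (Order.LTSeries.length_le_krullDim l).trans h

end ZariskiClosed

/-- A collinearity determinant as a polynomial in the coordinates of `(ℂ²)^S`. -/
def collinearPoly {S : Type*} (i j k : S) : MvPolynomial (S × Fin 2) ℂ :=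
  (X (j, 0) - X (i, 0)) * (X (k, 1) - X (i, 1)) - (X (k, 0) - X (i, 0)) * (X (j, 1) - X (i, 1))

theorem collinear_iff_det_eq_zero (p q r : ℂ × ℂ) :
    Collinear ℂ {p, q, r} ↔
      (q.1 - p.1) * (r.2 - p.2) - (r.1 - p.1) * (q.2 - p.2) = 0 := by
  rw [collinear_iff_of_mem (p₀ := p) (by simp)]
  constructor
  · rintro ⟨v, hv⟩
    obtain ⟨a, rfl⟩ := hv q (by simp)
    obtain ⟨b, rfl⟩ := hv r (by simp)
    simp
    ring
  · intro h
    by_cases hq : q = p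
    · refine ⟨r - p, ?_⟩
      rintro x (rfl | rfl | rfl)
      · exact ⟨0, by simp⟩
      · exact ⟨0, by simp [hq]⟩
      · exact ⟨1, by simp⟩
    · refine ⟨q - p, ?_⟩
      have hr : ∃ a : ℂ, r = a • (q - p) +ᵥ p := by
        by_cases h1 : q.1 - p.1 = 0
        · have h2 : q.2 - p.2 ≠ 0 := fun h2 ↦
            hq (Prod.ext (sub_eq_zero.1 h1) (sub_eq_zero.1 h2))
          have h3 : r.1 - p.1 = 0 := by simpa [h1, h2] using h
          refine ⟨(r.2 - p.2) / (q.2 - p.2), Prod.ext ?_ ?_⟩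
          · simp [h1, sub_eq_zero.1 h3]
          · simp [h2]
        · refine ⟨(r.1 - p.1) / (q.1 - p.1), Prod.ext ?_ ?_⟩
          · simp [h1]
          · simp
            field_simp
            linear_combination h
      rintro x (rfl | rfl | rfl)
      · exact ⟨0, by simp⟩
      · exact ⟨1, by simp⟩
      · exact hr

theorem collinear_image_iff {S : Type*} (Q : S → ℂ × ℂ) (i j k : S) :
    Collinear ℂ (Q '' {i, j, k}) ↔ eval (flatten Q) (collinearPoly i j k) = 0 := by
  simp [Set.image_insert_eq, collinear_iff_det_eq_zero, collinearPoly, flatten]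

theorem zClosed_KT {S : Type*} {T : Set (Set S)} (hT : ∀ t ∈ T, t.ncard = 3) :
    ZClosed (KT T) := by
  refine ⟨{f | ∃ i j k, {i, j, k} ∈ T ∧ f = collinearPoly i j k}, Set.ext fun Q ↦ ?_⟩
  constructor
  · rintro hQ _ ⟨i, j, k, ht, rfl⟩
    exact (collinear_image_iff Q i j k).1 (hQ _ ht)
  · intro hQ t ht
    obtain ⟨i, j, k, -, -, -, rfl⟩ := Set.ncard_eq_three.1 (hT t ht)
    exact (collinear_image_iff Q i j k).2 (hQ _ ⟨i, j, k, ht, rfl⟩)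

/-- The local ring of an irreducible closed set `V` at a point `Q`, together with the tautological
point of `V` with coordinates in this ring and the evaluation at `Q`. -/
theorem ZIrred.exists_localRing {S : Type} {V : Set (S → ℂ × ℂ)} (hV : ZIrred V)
    {Q : S → ℂ × ℂ} (hQ : Q ∈ V) :
    ∃ (O : Type) (_ : CommRing O) (_ : IsDomain O) (_ : Algebra ℂ O) (ξ : S × Fin 2 → O)
      (ev : O →ₐ[ℂ] ℂ), (∀ x, ev x ≠ 0 → IsUnit x) ∧ (∀ v, ev (ξ v) = flatten Q v) ∧
        RingHom.ker (aeval ξ : MvPolynomial (S × Fin 2) ℂ →ₐ[ℂ] O) = idealOf V := by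
  have := hV.isPrime_idealOf
  let A := MvPolynomial (S × Fin 2) ℂ ⧸ idealOf V
  let φ : A →ₐ[ℂ] ℂ := Ideal.Quotient.liftₐ (idealOf V) (aeval (flatten Q))
    fun f hf ↦ by simpa [aeval_eq_eval] using mem_idealOf.1 hf Q hQ
  let m := RingHom.ker φ
  have : m.IsPrime := RingHom.ker_isPrime φ
  let O := Localization.AtPrime m
  have : IsDomain O := IsLocalization.isDomain_localization m.primeCompl_le_nonZeroDivisors
  let ev : O →ₐ[ℂ] ℂ := IsLocalization.liftAlgHom (M := m.primeCompl) (f := φ)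
    fun s ↦ isUnit_iff_ne_zero.2 s.2
  have hev (a : A) : ev (algebraMap A O a) = φ a := IsLocalization.lift_eq _ a
  let ψ : MvPolynomial (S × Fin 2) ℂ →ₐ[ℂ] O :=
    (IsScalarTower.toAlgHom ℂ A O).comp (Ideal.Quotient.mkₐ ℂ (idealOf V))
  refine ⟨O, inferInstance, this, inferInstance, fun v ↦ ψ (X v), ev, fun x hx ↦ ?_, fun v ↦ ?_, ?_⟩
  · have hker : (RingHom.ker ev).IsMaximal := RingHom.ker_isMaximal_of_surjective ev
      fun z ↦ ⟨algebraMap ℂ O z, ev.commutes z⟩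
    by_contra hu
    have hmem : x ∈ RingHom.ker ev := by
      rw [IsLocalRing.eq_maximalIdeal hker]
      exact (IsLocalRing.mem_maximalIdeal x).2 hu
    exact hx hmem
  · exact (hev _).trans (aeval_X (flatten Q) v)
  · have : (aeval fun v ↦ ψ (X v)) = ψ := by ext; simp
    rw [this]
    ext f
    rw [RingHom.mem_ker]
    change algebraMap A O (Ideal.Quotient.mk _ f) = 0 ↔ _
    rw [FaithfulSMul.algebraMap_eq_zero_iff, Ideal.Quotient.eq_zero_iff_mem]

/-- Over a domain `O` with an evaluation map `ev` to `ℂ` whose non-kernel consists of units, suppose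
points `(x s, y s)` with distinct specializations satisfy every collinearity relation among those
specializing to points of the line `l`. Then `l` lifts to a line over `O` through all of them. -/
theorem exists_line_lift {S O : Type} [CommRing O] [IsDomain O] [Algebra ℂ O] (ev : O →ₐ[ℂ] ℂ)
    (hunit : ∀ z, ev z ≠ 0 → IsUnit z) (x y : S → O)
    (hinj : Function.Injective fun s ↦ (ev (x s), ev (y s))) (l : ℂ × ℂ)
    (hcol : ∀ i j k, i ≠ j → i ≠ k → j ≠ k → (ev (x i), ev (y i)) ∈ lineOf l →
      (ev (x j), ev (y j)) ∈ lineOf l → (ev (x k), ev (y k)) ∈ lineOf l →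
      (x j - x i) * (y k - y i) - (x k - x i) * (y j - y i) = 0) :
    ∃ a b : O, ev a = l.1 ∧ ev b = -l.2 ∧
      ∀ s, (ev (x s), ev (y s)) ∈ lineOf l → y s = a * x s - b := by
  by_cases hne : ∃ s, (ev (x s), ev (y s)) ∈ lineOf l
  swap
  · exact ⟨algebraMap ℂ O l.1, algebraMap ℂ O (-l.2), ev.commutes _, ev.commutes _,
      fun s hs ↦ (hne ⟨s, hs⟩).elim⟩
  obtain ⟨s, hs⟩ := hne
  have hs' : ev (y s) = l.1 * ev (x s) + l.2 := hs
  by_cases hone : ∃ t, t ≠ s ∧ (ev (x t), ev (y t)) ∈ lineOf l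
  swap
  · refine ⟨algebraMap ℂ O l.1, algebraMap ℂ O l.1 * x s - y s, ev.commutes _, ?_, fun t ht ↦ ?_⟩
    · have : ev (algebraMap ℂ O l.1) = l.1 := ev.commutes _
      rw [map_sub, map_mul, this, hs']
      ring
    · obtain rfl : t = s := by
        by_contra h
        exact hone ⟨t, h, ht⟩
      ring
  obtain ⟨t, hts, ht⟩ := hone
  have ht' : ev (y t) = l.1 * ev (x t) + l.2 := ht
  have hx : ev (x t - x s) ≠ 0 := by
    intro h
    have hxx : ev (x t) = ev (x s) := by rwa [map_sub, sub_eq_zero] at h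
    exact hts (hinj (Prod.ext hxx (by simp [hs', ht', hxx])))
  obtain ⟨w, hw⟩ := (hunit _ hx).exists_right_inv
  have hevw : ev (x t - x s) * ev w = 1 := by rw [← map_mul, hw, map_one]
  have hslope : ev ((y t - y s) * w) = l.1 := by
    rw [map_mul, map_sub, hs', ht']
    rw [map_sub] at hevw
    linear_combination l.1 * hevw
  refine ⟨(y t - y s) * w, (y t - y s) * w * x s - y s, hslope, ?_, fun u hu ↦ ?_⟩
  · rw [map_sub, map_mul, hslope, hs']
    ring
  · by_cases hus : u = s
    · subst hus; ring
    by_cases hut : u = t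
    · subst hut; linear_combination -(y u - y s) * hw
    · linear_combination w * hcol s t u (Ne.symm hts) (Ne.symm hus) (Ne.symm hut) hs ht hu -
        (y u - y s) * hw

/-- Rigidity of points from rigidity of lines via duality.  Here `P` is a finite
set of points of `ℂ²` and `L` a finite set of non-vertical lines (recorded by
their parameters `(a, b)` for `y = a x + b`), such that every point of `P` lies
on at least two lines of `L`.  If the tuple of dual points `d(L)` is `r`-rigid
with respect to the concurrency triples `T*` determined by `P`, then the tuple
`P` is `r`-rigid with respect to the collinearity triples `T` determined
by `L`. -/
theorem dual_rigidity (P : Set (ℂ × ℂ)) (L : Set (ℂ × ℂ))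
    (hPfin : P.Finite) (hLfin : L.Finite)
    (hcover : ∀ p ∈ P, ∃ l₁ ∈ L, ∃ l₂ ∈ L, l₁ ≠ l₂ ∧
      p ∈ lineOf l₁ ∧ p ∈ lineOf l₂)
    (r : ℕ) (hr : 0 < r)
    (hdual : IsRigid
      {t : Set ↥L | t.ncard = 3 ∧ ∃ p ∈ P, ∀ l ∈ t, p ∈ lineOf (l : ℂ × ℂ)}
      (fun l : ↥L => dualPoint (l : ℂ × ℂ)) r) :
    IsRigid
      {t : Set ↥P | t.ncard = 3 ∧ ∃ l ∈ L, ∀ p ∈ t, (p : ℂ × ℂ) ∈ lineOf l}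
      (fun p : ↥P => (p : ℂ × ℂ)) r := by
  have : Finite P := hPfin
  have : Finite L := hLfin
  refine ⟨fun t ⟨_, l, _, hl⟩ ↦ ?_, fun V hV hPV ↦ ?_⟩
  · refine (collinear_iff_exists_forall_eq_smul_vadd _).2 ⟨(0, l.2), (1, l.1), ?_⟩
    rintro _ ⟨p, hp, rfl⟩
    have hpl : p.1.2 = l.1 * p.1.1 + l.2 := hl p hp
    exact ⟨p.1.1, Prod.ext (by simp) (by simpa [mul_comm] using hpl)⟩
  obtain ⟨O, _, _, _, ξ, ev, hunit, hev, hker⟩ := hV.1.exists_localRing hPV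
  have hξ (p : P) : (ev (ξ (p, 0)), ev (ξ (p, 1))) = (p : ℂ × ℂ) := by
    simp [hev, flatten]
  have hlift (l : L) := exists_line_lift ev hunit (fun p : P ↦ ξ (p, 0)) (fun p ↦ ξ (p, 1))
    (fun p q h ↦ Subtype.ext (by simpa only [hξ] using h)) l.1 (by
      intro i j k hij hik hjk hi hj hk
      rw [hξ] at hi hj hk
      have hmem : collinearPoly i j k ∈ idealOf V := mem_idealOf.2 fun Q hQ ↦
        (collinear_image_iff Q i j k).1 <| hV.2.1 hQ _
          ⟨Set.ncard_eq_three.2 ⟨i, j, k, hij, hik, hjk, rfl⟩, l, l.2, by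
            rintro p (rfl | rfl | rfl) <;> assumption⟩
      rw [← hker, RingHom.mem_ker] at hmem
      simpa [collinearPoly] using hmem)
  choose a b ha hb hab using hlift
  simp only [hξ] at hab
  let η : L × Fin 2 → O := fun v ↦ if v.2 = 0 then a v.1 else b v.1
  let ψ : MvPolynomial (L × Fin 2) ℂ →ₐ[ℂ] O := aeval η
  let q := RingHom.ker ψ
  have hq : q.IsPrime := RingHom.ker_isPrime ψ
  have hW := zIrred_zeroSet q
  have hWK : zeroSet q ⊆
      KT {t : Set L | t.ncard = 3 ∧ ∃ p ∈ P, ∀ l ∈ t, p ∈ lineOf (l : ℂ × ℂ)} := by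
    rintro Q hQ t ⟨ht, p, hp, hpt⟩
    obtain ⟨i, j, k, -, -, -, rfl⟩ := Set.ncard_eq_three.1 ht
    refine (collinear_image_iff Q i j k).2 (mem_zeroSet.1 hQ _ ?_)
    have hi := hab i ⟨p, hp⟩ (hpt i (by simp))
    have hj := hab j ⟨p, hp⟩ (hpt j (by simp))
    have hk := hab k ⟨p, hp⟩ (hpt k (by simp))
    rw [RingHom.mem_ker]
    simp only [collinearPoly, ψ, η, map_sub, map_mul, aeval_X]
    simp only [if_true, one_ne_zero, if_false]
    linear_combination (a k - a j) * hi + (a i - a k) * hj + (a j - a i) * hk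
  have hdW : (fun l : L ↦ dualPoint (l : ℂ × ℂ)) ∈ zeroSet q := by
    refine mem_zeroSet.2 fun f hf ↦ ?_
    have hη : (fun v ↦ ev (η v)) = flatten fun l : L ↦ dualPoint (l : ℂ × ℂ) := by
      ext ⟨l, i⟩
      fin_cases i <;> simp [η, flatten, dualPoint, ha, hb]
    rw [← aeval_eq_eval, ← hη]
    have : aeval (fun v ↦ ev (η v)) f = ev (ψ f) := (comp_aeval_apply η ev f).symm
    rw [this, show ψ f = 0 from hf, map_zero]
  obtain ⟨W, hWc, hqW⟩ := exists_isIrredComponent (zClosed_KT fun t ht ↦ ht.1) hW hWK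
  have hdim : ZDimLE (zeroSet q) r := fun k c hc hcq ↦
    hdual.2 W hWc (hqW hdW) k c hc fun i ↦ (hcq i).trans hqW
  rw [hW.zDimLE_iff, idealOf_zeroSet] at hdim
  rw [hV.1.zDimLE_iff]
  refine le_trans ?_ hdim
  have := hV.1.isPrime_idealOf
  let f : MvPolynomial (P × Fin 2) ℂ ⧸ idealOf V →ₐ[ℂ] O :=
    Ideal.Quotient.liftₐ _ (aeval ξ) fun g hg ↦ by rwa [← hker] at hg
  let g : MvPolynomial (L × Fin 2) ℂ ⧸ q →ₐ[ℂ] O := Ideal.kerLiftAlg ψ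
  let _ : Algebra (MvPolynomial (L × Fin 2) ℂ ⧸ q) O := g.toRingHom.toAlgebra
  have : IsScalarTower ℂ (MvPolynomial (L × Fin 2) ℂ ⧸ q) O :=
    .of_algebraMap_eq fun z ↦ (g.commutes z).symm
  have hg : Function.Injective (algebraMap (MvPolynomial (L × Fin 2) ℂ ⧸ q) O) :=
    Ideal.kerLiftAlg_injective ψ
  refine ringKrullDim_le_of_isAlgebraic hg f ?_ ?_
  · refine (injective_iff_map_eq_zero f).2 fun z hz ↦ ?_
    obtain ⟨z, rfl⟩ := Ideal.Quotient.mk_surjective z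
    rw [Ideal.Quotient.eq_zero_iff_mem, ← hker]
    exact hz
  have halg_η (v : L × Fin 2) : IsAlgebraic (MvPolynomial (L × Fin 2) ℂ ⧸ q) (η v) := by
    have : η v = algebraMap (MvPolynomial (L × Fin 2) ℂ ⧸ q) O (Ideal.Quotient.mk q (X v)) :=
      (aeval_X η v).symm
    rw [this]
    exact isAlgebraic_algebraMap _
  have halg_a (l : L) : IsAlgebraic (MvPolynomial (L × Fin 2) ℂ ⧸ q) (a l) := halg_η (l, 0)
  have halg_b (l : L) : IsAlgebraic (MvPolynomial (L × Fin 2) ℂ ⧸ q) (b l) := halg_η (l, 1)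
  have halg_x (p : P) : IsAlgebraic (MvPolynomial (L × Fin 2) ℂ ⧸ q) (ξ (p, 0)) := by
    obtain ⟨l₁, h₁, l₂, h₂, hne, hp₁, hp₂⟩ := hcover p p.2
    have e₁ := hab ⟨l₁, h₁⟩ p hp₁
    have e₂ := hab ⟨l₂, h₂⟩ p hp₂
    have hne' : a ⟨l₁, h₁⟩ - a ⟨l₂, h₂⟩ ≠ 0 := by
      intro h
      have hs : l₁.1 = l₂.1 := by rw [← ha ⟨l₁, h₁⟩, ← ha ⟨l₂, h₂⟩, sub_eq_zero.1 h]
      have hp₁ : p.1.2 = l₁.1 * p.1.1 + l₁.2 := hp₁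
      have hp₂ : p.1.2 = l₂.1 * p.1.1 + l₂.2 := hp₂
      refine hne (Prod.ext hs ?_)
      linear_combination hp₂ - hp₁ - p.1.1 * hs
    refine IsAlgebraic.of_mul (mem_nonZeroDivisors_of_ne_zero hne')
      ((halg_a _).sub (halg_a _)) ?_
    have : (a ⟨l₁, h₁⟩ - a ⟨l₂, h₂⟩) * ξ (p, 0) = b ⟨l₁, h₁⟩ - b ⟨l₂, h₂⟩ := by
      linear_combination e₂ - e₁
    exact this ▸ (halg_b _).sub (halg_b _)
  have halg_y (p : P) : IsAlgebraic (MvPolynomial (L × Fin 2) ℂ ⧸ q) (ξ (p, 1)) := by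
    obtain ⟨l, hl, -, -, -, hp, -⟩ := hcover p p.2
    rw [hab ⟨l, hl⟩ p hp]
    exact ((halg_a _).mul (halg_x p)).sub (halg_b _)
  intro z
  obtain ⟨z, rfl⟩ := Ideal.Quotient.mk_surjective z
  change IsAlgebraic _ (aeval ξ z)
  induction z using MvPolynomial.induction_on with
  | C c =>
    rw [aeval_C, IsScalarTower.algebraMap_apply ℂ (MvPolynomial (L × Fin 2) ℂ ⧸ q) O]
    exact isAlgebraic_algebraMap _
  | add _ _ h₁ h₂ =>
    rw [map_add]
    exact h₁.add h₂
  | mul_X _ v h =>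
    obtain ⟨p, i⟩ := v
    rw [map_mul, aeval_X]
    fin_cases i
    · exact h.mul (halg_x p)
    · exact h.mul (halg_y p)
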